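/- arXiv:2511.09718 — 2 statements merged into one kernel-verified Lean document; each statement's English description precedes it below -/
import Mathlib

section
/- Let X be a compact metric space, λ a Borel probability measure on X, and f : X → X continuous. Then the statistical attractor A_stat(f) is the smallest closed set containing the σ-limit sets of λ-almost all trajectories: σ_f(x) ⊆ A_stat(f) for λ-almost every x ∈ X, and every closed set B ⊆ X with σ_f(x) ⊆ B for λ-almost every x satisfies A_stat(f) ⊆ B. -/
open MeasureTheory Set Filter Topology

noncomputable section

/-- Birkhoff average of visits of the orbit of `x` to `U` up to time `n`. -/
def birkhoffAvg {X : Type*} (f : X → X) (U : Set X) (n : ℕ) (x : X) : ℝ :=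
  (∑ k ∈ Finset.range n, U.indicator (fun _ => (1:ℝ)) (f^[k] x)) / n

/-- The σ-limit set of `x` under `f`: points every neighborhood of which is visited by
the orbit of `x` with positive upper average frequency. -/
def sigmaLim {X : Type*} [TopologicalSpace X] (f : X → X) (x : X) : Set X :=
  {z | ∀ U : Set X, IsOpen U → z ∈ U →
    0 < Filter.limsup (fun n => birkhoffAvg f U n x) Filter.atTop}

/-- The statistical attractor. -/
def statAttr {X : Type*} [TopologicalSpace X] [MeasurableSpace X]
    (lam : Measure X) (f : X → X) : Set X :=
  univ \ ⋃₀ {U : Set X | IsOpen U ∧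
    ∀ᵐ x ∂lam, Tendsto (fun n => birkhoffAvg f U n x) atTop (nhds 0)}

theorem birkhoffAvg_nonneg {X : Type*} (f : X → X) (U : Set X) (n : ℕ) (x : X) :
    0 ≤ birkhoffAvg f U n x :=
  div_nonneg (Finset.sum_nonneg fun _ _ => indicator_nonneg (fun _ _ => zero_le_one) _)
    n.cast_nonneg

theorem birkhoffAvg_le_one {X : Type*} (f : X → X) (U : Set X) (n : ℕ) (x : X) :
    birkhoffAvg f U n x ≤ 1 := by
  refine div_le_one_of_le₀ ?_ n.cast_nonneg
  calc ∑ k ∈ Finset.range n, U.indicator (fun _ => (1 : ℝ)) (f^[k] x)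
      ≤ ∑ _k ∈ Finset.range n, (1 : ℝ) :=
        Finset.sum_le_sum fun _ _ => indicator_le_self' (fun _ _ => zero_le_one) _
    _ = n := by simp

theorem birkhoffAvg_mono {X : Type*} (f : X → X) {U V : Set X} (h : U ⊆ V) (n : ℕ) (x : X) :
    birkhoffAvg f U n x ≤ birkhoffAvg f V n x := by
  unfold birkhoffAvg
  gcongr

theorem birkhoffAvg_union_le {X : Type*} (f : X → X) (U V : Set X) (n : ℕ) (x : X) :
    birkhoffAvg f (U ∪ V) n x ≤ birkhoffAvg f U n x + birkhoffAvg f V n x := by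
  unfold birkhoffAvg
  rw [← add_div, ← Finset.sum_add_distrib]
  gcongr with k
  by_cases hU : f^[k] x ∈ U <;> by_cases hV : f^[k] x ∈ V <;> simp [hU, hV]

theorem tendsto_birkhoffAvg_zero_of_limsup_nonpos {X : Type*} {f : X → X} {U : Set X} {x : X}
    (h : limsup (fun n => birkhoffAvg f U n x) atTop ≤ 0) :
    Tendsto (fun n => birkhoffAvg f U n x) atTop (𝓝 0) := by
  have hle : IsBoundedUnder (· ≤ ·) atTop fun n => birkhoffAvg f U n x :=
    isBoundedUnder_of ⟨1, fun n => birkhoffAvg_le_one f U n x⟩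
  have hge : IsBoundedUnder (· ≥ ·) atTop fun n => birkhoffAvg f U n x :=
    isBoundedUnder_of ⟨0, fun n => birkhoffAvg_nonneg f U n x⟩
  exact tendsto_of_le_liminf_of_limsup_le
    (le_liminf_of_le hle.isCoboundedUnder_ge
      (Eventually.of_forall fun n => birkhoffAvg_nonneg f U n x)) h hle hge

/-- The orbit of `x` visits a compact set disjoint from its σ-limit set with zero frequency. -/
theorem IsCompact.tendsto_birkhoffAvg_zero {X : Type*} [TopologicalSpace X] {f : X → X} {x : X}
    {K : Set X} (hK : IsCompact K) (hd : Disjoint K (sigmaLim f x)) :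
    Tendsto (fun n => birkhoffAvg f K n x) atTop (𝓝 0) := by
  refine hK.induction_on (p := fun s => Tendsto (fun n => birkhoffAvg f s n x) atTop (𝓝 0))
    (by simp [birkhoffAvg]) (fun s t hst ht => ?_) (fun s t hs ht => ?_) (fun y hy => ?_)
  · exact squeeze_zero (fun n => birkhoffAvg_nonneg f s n x)
      (fun n => birkhoffAvg_mono f hst n x) ht
  · exact squeeze_zero (fun n => birkhoffAvg_nonneg f _ n x)
      (fun n => birkhoffAvg_union_le f s t n x) (by simpa using hs.add ht)
  · have hy' : y ∉ sigmaLim f x := disjoint_left.1 hd hy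
    simp only [sigmaLim, mem_ofPred_eq, not_forall, not_lt] at hy'
    obtain ⟨U, hU, hyU, hlim⟩ := hy'
    exact ⟨U, mem_nhdsWithin_of_mem_nhds (hU.mem_nhds hyU),
      tendsto_birkhoffAvg_zero_of_limsup_nonpos hlim⟩

theorem isClosed_statAttr {X : Type*} [TopologicalSpace X] [MeasurableSpace X]
    (lam : Measure X) (f : X → X) : IsClosed (statAttr lam f) := by
  rw [statAttr, ← compl_eq_univ_sdiff]
  exact (isOpen_sUnion fun U hU => hU.1).isClosed_compl

theorem ae_sigmaLim_subset_statAttr {X : Type*} [TopologicalSpace X] [SecondCountableTopology X]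
    [MeasurableSpace X] (lam : Measure X) (f : X → X) :
    ∀ᵐ x ∂lam, sigmaLim f x ⊆ statAttr lam f := by
  obtain ⟨T, hTc, hTS, hTU⟩ := TopologicalSpace.isOpen_sUnion_countable
    {U : Set X | IsOpen U ∧ ∀ᵐ x ∂lam, Tendsto (fun n => birkhoffAvg f U n x) atTop (𝓝 0)}
    fun U hU => hU.1
  have hT : ∀ᵐ x ∂lam, ∀ U ∈ T, Tendsto (fun n => birkhoffAvg f U n x) atTop (𝓝 0) :=
    (ae_ball_iff hTc).2 fun U hU => (hTS hU).2
  filter_upwards [hT] with x hx z hz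
  refine ⟨mem_univ z, fun hmem => ?_⟩
  rw [← hTU] at hmem
  obtain ⟨U, hU, hzU⟩ := hmem
  exact (hz U (hTS hU).1 hzU).ne' (hx U hU).limsup_eq

theorem statAttr_subset_of_isClosed {X : Type*} [TopologicalSpace X]
    [LocallyCompactSpace X] [MeasurableSpace X] {lam : Measure X} {f : X → X} {B : Set X}
    (hB : IsClosed B) (h : ∀ᵐ x ∂lam, sigmaLim f x ⊆ B) : statAttr lam f ⊆ B := by
  intro z hz
  by_contra hzB
  obtain ⟨K, hK, hzK, hKB⟩ := exists_compact_subset hB.isOpen_compl hzB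
  refine hz.2 ⟨interior K, ⟨isOpen_interior, ?_⟩, hzK⟩
  filter_upwards [h] with x hx
  exact squeeze_zero (fun n => birkhoffAvg_nonneg f _ n x)
    (fun n => birkhoffAvg_mono f interior_subset n x)
    (hK.tendsto_birkhoffAvg_zero
      (disjoint_left.2 fun y hy hyx => hKB hy (hx hyx)))

/-- the statistical attractor is the smallest closed set containing the
σ-limit sets of almost all points. -/
theorem stmt4 {X : Type*} [MetricSpace X] [CompactSpace X]
    [MeasurableSpace X] [BorelSpace X]
    (lam : Measure X) [IsProbabilityMeasure lam]
    (f : X → X) (hf : Continuous f) :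
    IsClosed (statAttr lam f) ∧
    (∀ᵐ x ∂lam, sigmaLim f x ⊆ statAttr lam f) ∧
    (∀ B : Set X, IsClosed B → (∀ᵐ x ∂lam, sigmaLim f x ⊆ B) →
      statAttr lam f ⊆ B) :=
  ⟨isClosed_statAttr lam f, ae_sigmaLim_subset_statAttr lam f,
    fun _ hB h => statAttr_subset_of_isClosed hB h⟩
end
end

section
/- Let X be a compact metric space with a Borel probability measure λ and let f : X → X be continuous. Then the following chain of inclusions holds: A_phys(f) ⊆ A_stat(f) ⊆ Λ(f) ⊆ Ω(f). -/
open MeasureTheory Set Filter Topology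

noncomputable section

/-- The ω-limit set of `x` under `f`. -/
def omegaLim {X : Type*} [TopologicalSpace X] (f : X → X) (x : X) : Set X :=
  ⋂ n : ℕ, closure {y | ∃ m, n ≤ m ∧ f^[m] x = y}

/-- The global Milnor attractor. -/
def milnorAttr {X : Type*} [TopologicalSpace X] [MeasurableSpace X]
    (lam : Measure X) (f : X → X) : Set X :=
  ⋂₀ {A : Set X | IsClosed A ∧ ∀ᵐ x ∂lam, omegaLim f x ⊆ A}

/-- Essential open sets. -/
def Essential {X : Type*} [MeasurableSpace X] (lam : Measure X)
    (f : X → X) (U : Set X) : Prop :=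
  ∃ ε > (0:ℝ), ∃ δ > (0:ℝ), ∃ k : ℕ → ℕ, Tendsto k atTop atTop ∧
    ∀ n, ENNReal.ofReal δ < lam {x | ε < birkhoffAvg f U (k n) x}

/-- The physical attractor. -/
def physAttr {X : Type*} [TopologicalSpace X] [MeasurableSpace X]
    (lam : Measure X) (f : X → X) : Set X :=
  univ \ ⋃₀ {U : Set X | IsOpen U ∧ ¬ Essential lam f U}

/-- The non-wandering set of `f`. -/
def nonWandering {X : Type*} [TopologicalSpace X] (f : X → X) : Set X :=
  {x | ∀ U : Set X, IsOpen U → x ∈ U → ∃ n, 1 ≤ n ∧ ((f^[n] '' U) ∩ U).Nonempty}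

theorem measurable_birkhoffAvg {X : Type*} [MeasurableSpace X] {f : X → X} (hf : Measurable f)
    {U : Set X} (hU : MeasurableSet U) (n : ℕ) : Measurable (birkhoffAvg f U n) := by
  unfold birkhoffAvg
  refine Measurable.div_const ?_ _
  exact Finset.measurable_sum _ fun k _ =>
    (measurable_const.indicator hU).comp (hf.iterate k)

theorem not_essential_of_tendsto_birkhoffAvg {X : Type*} [MeasurableSpace X] {lam : Measure X}
    [IsFiniteMeasure lam] {f : X → X} (hf : Measurable f) {U : Set X} (hU : MeasurableSet U)
    (h : ∀ᵐ x ∂lam, Tendsto (fun n => birkhoffAvg f U n x) atTop (𝓝 0)) :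
    ¬ Essential lam f U := by
  rintro ⟨ε, hε, δ, hδ, k, hk, hlt⟩
  have hm : TendstoInMeasure lam (birkhoffAvg f U) atTop (fun _ => (0 : ℝ)) :=
    tendstoInMeasure_of_tendsto_ae
      (fun n => (measurable_birkhoffAvg hf hU n).aestronglyMeasurable) h
  have hlim := (hm (ENNReal.ofReal ε) (ENNReal.ofReal_pos.2 hε)).comp hk
  obtain ⟨n, hn⟩ := (hlim.eventually (gt_mem_nhds (ENNReal.ofReal_pos.2 hδ))).exists
  refine lt_irrefl _ ((hlt n).trans_le ((measure_mono fun x hx => ?_).trans hn.le))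
  simp only [mem_ofPred_eq, edist_dist, Real.dist_0_eq_abs] at hx ⊢
  exact ENNReal.ofReal_le_ofReal (hx.le.trans (le_abs_self _))

theorem tendsto_birkhoffAvg_of_eventually_notMem {X : Type*} {f : X → X} {U : Set X} {x : X}
    (h : ∀ᶠ n in atTop, f^[n] x ∉ U) :
    Tendsto (fun n => birkhoffAvg f U n x) atTop (𝓝 0) := by
  have hu : Tendsto (fun n => U.indicator (fun _ => (1 : ℝ)) (f^[n] x)) atTop (𝓝 0) :=
    tendsto_const_nhds.congr' (h.mono fun n hn => (indicator_of_notMem hn _).symm)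
  refine hu.cesaro.congr fun n => ?_
  rw [birkhoffAvg, div_eq_inv_mul]

theorem mem_omegaLim_iff_mapClusterPt {X : Type*} [TopologicalSpace X] {f : X → X} {x y : X} :
    y ∈ omegaLim f x ↔ MapClusterPt y atTop (fun n => f^[n] x) := by
  simp only [omegaLim, mem_iInter, mem_closure_iff_nhds, mapClusterPt_iff_frequently,
    frequently_atTop]
  constructor
  · intro h s hs n
    obtain ⟨_, hz, m, hm, rfl⟩ := h n s hs
    exact ⟨m, hm, hz⟩
  · intro h n s hs
    obtain ⟨m, hm, hz⟩ := h s hs n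
    exact ⟨_, hz, m, hm, rfl⟩

theorem eventually_notMem_of_disjoint_omegaLim {X : Type*} [TopologicalSpace X] [CompactSpace X]
    {f : X → X} {x : X} {K : Set X} (hK : IsClosed K) (h : Disjoint (omegaLim f x) K) :
    ∀ᶠ n in atTop, f^[n] x ∉ K := by
  by_contra hn
  obtain ⟨y, hyK, hy⟩ := hK.isCompact.exists_mapClusterPt_of_frequently hn
  exact disjoint_left.1 h (mem_omegaLim_iff_mapClusterPt.2 hy) hyK

theorem isClosed_nonWandering {X : Type*} [TopologicalSpace X] (f : X → X) :
    IsClosed (nonWandering f) := by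
  refine isClosed_of_closure_subset fun x hx U hU hxU => ?_
  obtain ⟨y, hyU, hy⟩ := mem_closure_iff.1 hx U hU hxU
  exact hy U hU hyU

theorem omegaLim_subset_nonWandering {X : Type*} [TopologicalSpace X] (f : X → X) (x : X) :
    omegaLim f x ⊆ nonWandering f := by
  intro y hy U hU hyU
  have hfreq := frequently_atTop.1 ((mem_omegaLim_iff_mapClusterPt.1 hy).frequently
    (hU.mem_nhds hyU))
  obtain ⟨m, -, hm⟩ := hfreq 0
  obtain ⟨p, hp, hpU⟩ := hfreq (m + 1)
  refine ⟨p - m, by omega, f^[p] x, ⟨f^[m] x, hm, ?_⟩, hpU⟩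
  rw [← Function.iterate_add_apply, Nat.sub_add_cancel (by omega)]

/-- the chain of inclusions
`A_phys(f) ⊆ A_stat(f) ⊆ Λ(f) ⊆ Ω(f)`. -/
theorem stmt6 {X : Type*} [MetricSpace X] [CompactSpace X]
    [MeasurableSpace X] [BorelSpace X]
    (lam : Measure X) [IsProbabilityMeasure lam]
    (f : X → X) (hf : Continuous f) :
    physAttr lam f ⊆ statAttr lam f ∧
    statAttr lam f ⊆ milnorAttr lam f ∧
    milnorAttr lam f ⊆ nonWandering f := by
  refine ⟨?_, ?_, ?_⟩
  · exact sdiff_subset_sdiff_right (sUnion_subset_sUnion fun U ⟨hU, h⟩ =>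
      ⟨hU, not_essential_of_tendsto_birkhoffAvg hf.measurable hU.measurableSet h⟩)
  · rintro x ⟨-, hx⟩ A ⟨hA, hω⟩
    by_contra hxA
    obtain ⟨K, ⟨hKx, hK⟩, hKA⟩ :=
      (closed_nhds_basis x).mem_iff.1 (hA.isOpen_compl.mem_nhds hxA)
    refine hx ⟨interior K, ⟨isOpen_interior, ?_⟩, mem_interior_iff_mem_nhds.2 hKx⟩
    filter_upwards [hω] with z hz
    have hdisj : Disjoint (omegaLim f z) K :=
      disjoint_left.2 fun y hy hyK => hKA hyK (hz hy)
    exact tendsto_birkhoffAvg_of_eventually_notMem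
      ((eventually_notMem_of_disjoint_omegaLim hK hdisj).mono fun _ hn hmem =>
        hn (interior_subset hmem))
  · exact sInter_subset_of_mem
      ⟨isClosed_nonWandering f, ae_of_all _ (omegaLim_subset_nonWandering f)⟩
end
end
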